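/- Under the AOD algorithm with horizon T (losses valued in [0,1], convex, G-Lipschitz gradients, domain diameter at most D), for every comparator sequence u_1,…,u_T ∈ Ω with path-length P_T = Σ_{t=1}^{T−1} ‖u_{t+1}−u_t‖₂, the dynamic regret satisfies Σ_{t=1}^T f_t(w_t) − Σ_{t=1}^T f_t(u_t) ≤ ( (3DG)/2 + (5G/2)·√(D·P_T) + √( 6·c(T)·(1 + 2P_T/D) ) )·√T, where c(T) = 1 + ln T + ln(1 + log₂ T) + ln( (5 + 3 ln(1+T))/2 ). -/

import Mathlib

/-- The AdaNormalHedge potential `Φ(R,C) = exp([R]₊²/(3C))` (with `Φ(R,0) = 1`,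
matching `Φ(0,0) = 1`, since `x/0 = 0` in Lean). -/
noncomputable def anhPot (R C : ℝ) : ℝ := Real.exp (max R 0 ^ 2 / (3 * C))

/-- The AdaNormalHedge weight function `w(R,C) = (Φ(R+1,C+1) − Φ(R−1,C+1))/2`. -/
noncomputable def anhW (R C : ℝ) : ℝ := (anhPot (R + 1) (C + 1) - anhPot (R - 1) (C + 1)) / 2

/-- The starting round `(i−1)·2^k + 1` of the interval of the dense geometric covering
level `D_k` that contains round `t ≥ 1`. -/
def dgcStart (k t : ℕ) : ℕ := (t - 1) / 2 ^ k * 2 ^ k + 1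

/-- The levels `k` with `2^k ≤ T` of the dense geometric covering collection
`D = ∪_{k ≥ 0, 2^k ≤ T} D_k`, `D_k = {[(i−1)·2^k + 1, i·2^k] : i ≥ 1}`.  At every round
exactly one interval of each level is active, so experts are indexed by levels. -/
def dgcLevels (T : ℕ) : Finset ℕ := (Finset.range (T + 1)).filter fun k => 2 ^ k ≤ T

/-- `R_{t−1,I} = Σ_{u=min I}^{t−1} (f_u(w_u) − f_u(w_{u,I}))` for the active level-`k`
expert at round `t` (whose interval starts at `dgcStart k t`); `x k u` is the action of
the level-`k` expert at round `u`. -/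
noncomputable def aodMetaR {α : Type*} (f : ℕ → α → ℝ) (w : ℕ → α) (x : ℕ → ℕ → α)
    (k t : ℕ) : ℝ :=
  ∑ u ∈ Finset.Icc (dgcStart k t) (t - 1), (f u (w u) - f u (x k u))

/-- `C_{t−1,I} = Σ_{u=min I}^{t−1} |f_u(w_u) − f_u(w_{u,I})|` for the active level-`k`
expert at round `t`. -/
noncomputable def aodMetaC {α : Type*} (f : ℕ → α → ℝ) (w : ℕ → α) (x : ℕ → ℕ → α)
    (k t : ℕ) : ℝ :=
  ∑ u ∈ Finset.Icc (dgcStart k t) (t - 1), |f u (w u) - f u (x k u)|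

/-- The AdaNormalHedge weight `p_{t,I}` that AOD assigns to the active level-`k`
expert at round `t`. -/
noncomputable def aodWeight {α : Type*} (T : ℕ) (f : ℕ → α → ℝ) (w : ℕ → α)
    (x : ℕ → ℕ → α) (k t : ℕ) : ℝ :=
  anhW (aodMetaR f w x k t) (aodMetaC f w x k t) /
    ∑ k' ∈ dgcLevels T, anhW (aodMetaR f w x k' t) (aodMetaC f w x k' t)

/-- `c(t) = 1 + ln t + ln(1 + log₂ T) + ln((5 + 3 ln(1+t))/2)`. -/
noncomputable def cAOD (T t : ℕ) : ℝ :=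
  1 + Real.log t + Real.log (1 + Real.logb 2 T) + Real.log ((5 + 3 * Real.log (1 + (t : ℝ))) / 2)

section OnlineGradientDescent

variable {E : Type*} [NormedAddCommGroup E] [InnerProductSpace ℝ E]

theorem ConvexOn.sub_le_inner_gradient [CompleteSpace E] {φ : E → ℝ}
    (hφ : ConvexOn ℝ Set.univ φ) {y : E} (hd : DifferentiableAt ℝ φ y) (z : E) :
    φ y - φ z ≤ inner ℝ (gradient φ y) (y - z) := by
  have hline : ConvexOn ℝ Set.univ (φ ∘ AffineMap.lineMap (k := ℝ) y z) := by
    simpa using hφ.comp_affineMap (AffineMap.lineMap (k := ℝ) y z)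
  have hderiv : HasDerivAt (φ ∘ AffineMap.lineMap (k := ℝ) y z)
      (inner ℝ (gradient φ y) (z - y)) 0 := by
    have h₁ : HasFDerivAt φ (InnerProductSpace.toDual ℝ E (gradient φ y))
        (AffineMap.lineMap (k := ℝ) y z (0 : ℝ)) := by
      simpa using hd.hasGradientAt.hasFDerivAt
    simpa using h₁.comp_hasDerivAt (0 : ℝ) AffineMap.hasDerivAt_lineMap
  have h := hline.le_slope_of_hasDerivAt (Set.mem_univ 0) (Set.mem_univ 1) one_pos hderiv
  rw [← neg_sub z y, inner_neg_right]
  simp only [slope_def_field, Function.comp_apply, AffineMap.lineMap_apply_one,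
    AffineMap.lineMap_apply_zero, sub_zero, div_one] at h
  linarith

theorem norm_sub_le_of_isNearest {K : Set E} (hK : Convex ℝ K) {p z z' : E} (hp : p ∈ K)
    (hmin : ∀ y ∈ K, ‖p - z‖ ≤ ‖y - z‖) (hz' : z' ∈ K) : ‖p - z'‖ ≤ ‖z - z'‖ := by
  have hinf : ‖z - p‖ = ⨅ y : K, ‖z - y‖ := by
    have : Nonempty K := ⟨⟨p, hp⟩⟩
    refine le_antisymm (le_ciInf fun y => ?_) (ciInf_le ⟨0, ?_⟩ (⟨p, hp⟩ : K))
    · simpa [norm_sub_rev] using hmin y y.2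
    · rintro _ ⟨y, rfl⟩
      exact norm_nonneg _
  have hinner := (norm_eq_iInf_iff_real_inner_le_zero hK hp).1 hinf z' hz'
  have hexp : ‖z - z'‖ ^ 2 = ‖z - p‖ ^ 2 - 2 * inner ℝ (z - p) (z' - p) + ‖p - z'‖ ^ 2 := by
    rw [norm_sub_rev p z', ← norm_sub_sq_real, sub_sub_sub_cancel_right]
  refine (sq_le_sq₀ (norm_nonneg _) (norm_nonneg _)).1 ?_
  nlinarith [sq_nonneg ‖z - p‖]

theorem projected_gradient_step [CompleteSpace E] {K : Set E} (hK : Convex ℝ K) {φ : E → ℝ}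
    (hφ : ConvexOn ℝ Set.univ φ) {y y' v : E} (hd : DifferentiableAt ℝ φ y) {η G : ℝ}
    (hη : 0 < η) (hG : ‖gradient φ y‖ ≤ G) (hy' : y' ∈ K)
    (hmin : ∀ a ∈ K, ‖y' - (y - η • gradient φ y)‖ ≤ ‖a - (y - η • gradient φ y)‖)
    (hv : v ∈ K) :
    φ y - φ v ≤ (‖y - v‖ ^ 2 - ‖y' - v‖ ^ 2) / (2 * η) + η * G ^ 2 / 2 := by
  have h₁ := hφ.sub_le_inner_gradient hd v
  have h₂ := norm_sub_le_of_isNearest hK hy' hmin hv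
  have h₃ : ‖y - η • gradient φ y - v‖ ^ 2
      = ‖y - v‖ ^ 2 - 2 * η * inner ℝ (gradient φ y) (y - v) + η ^ 2 * ‖gradient φ y‖ ^ 2 := by
    rw [sub_right_comm, norm_sub_sq_real, inner_smul_right, real_inner_comm, norm_smul, mul_pow,
      Real.norm_eq_abs, sq_abs]
    ring
  have h₄ : ‖y' - v‖ ^ 2 ≤ ‖y - η • gradient φ y - v‖ ^ 2 := by gcongr
  have h₅ : ‖gradient φ y‖ ^ 2 ≤ G ^ 2 := by gcongr
  have h₆ : η ^ 2 * ‖gradient φ y‖ ^ 2 ≤ η ^ 2 * G ^ 2 := by gcongr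
  have h₇ : inner ℝ (gradient φ y) (y - v)
      ≤ (‖y - v‖ ^ 2 - ‖y' - v‖ ^ 2 + η ^ 2 * G ^ 2) / (2 * η) := by
    rw [le_div_iff₀ (by positivity)]
    linarith
  calc φ y - φ v ≤ _ := h₁.trans h₇
    _ = _ := by field_simp

theorem ogd_dynamic_regret [CompleteSpace E] {K : Set E} (hK : Convex ℝ K) {D G η : ℝ} {T : ℕ}
    (hT : 1 ≤ T) (hη : 0 < η) (hD : ∀ z ∈ K, ∀ z' ∈ K, ‖z - z'‖ ≤ D) {f : ℕ → E → ℝ}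
    (hconv : ∀ t, ConvexOn ℝ Set.univ (f t)) (hdiff : ∀ t z, DifferentiableAt ℝ (f t) z)
    (hgrad : ∀ t, ∀ z ∈ K, ‖gradient (f t) z‖ ≤ G) {x u : ℕ → E}
    (hx : ∀ t, 1 ≤ t → x t ∈ K) (hu : ∀ t, 1 ≤ t → t ≤ T → u t ∈ K)
    (hmin : ∀ t, 1 ≤ t → ∀ a ∈ K, ‖x (t + 1) - (x t - η • gradient (f t) (x t))‖
      ≤ ‖a - (x t - η • gradient (f t) (x t))‖) :
    ∑ t ∈ Finset.Icc 1 T, (f t (x t) - f t (u t))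
      ≤ (D ^ 2 + 2 * D * ∑ t ∈ Finset.Ico 1 T, ‖u (t + 1) - u t‖) / (2 * η)
        + η * T * G ^ 2 / 2 := by
  have hD0 : 0 ≤ D := (norm_nonneg _).trans (hD _ (hx 1 le_rfl) _ (hx 1 le_rfl))
  have hstep : ∀ t, 1 ≤ t → t ≤ T → f t (x t) - f t (u t)
      ≤ (‖x t - u t‖ ^ 2 - ‖x (t + 1) - u t‖ ^ 2) / (2 * η) + η * G ^ 2 / 2 := fun t h1 h2 =>
    projected_gradient_step hK (hconv t) (hdiff t _) hη (hgrad t _ (hx t h1))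
      (hx (t + 1) (by lia)) (hmin t h1) (hu t h1 h2)
  have key : ∀ n, 1 ≤ n → n ≤ T → ∑ t ∈ Finset.Icc 1 n, (f t (x t) - f t (u t))
      ≤ (D ^ 2 - ‖x (n + 1) - u n‖ ^ 2
          + 2 * D * ∑ t ∈ Finset.Ico 1 n, ‖u (t + 1) - u t‖) / (2 * η)
        + η * n * G ^ 2 / 2 := by
    intro n hn
    induction n, hn using Nat.le_induction with
    | base =>
      intro h
      have h₁ := hstep 1 le_rfl h
      have h₂ : ‖x 1 - u 1‖ ^ 2 ≤ D ^ 2 := by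
        gcongr
        exact hD _ (hx 1 le_rfl) _ (hu 1 le_rfl h)
      have h₃ : (‖x 1 - u 1‖ ^ 2 - ‖x (1 + 1) - u 1‖ ^ 2) / (2 * η)
          ≤ (D ^ 2 - ‖x (1 + 1) - u 1‖ ^ 2) / (2 * η) := by gcongr
      simpa using h₁.trans (add_le_add_left h₃ _)
    | succ n hn ih =>
      intro h
      have hun := hu n hn (by lia)
      have hun' := hu (n + 1) (by lia) h
      have hxn := hx (n + 1) (by lia)
      have h₁ := hstep (n + 1) (by lia) h
      have h₂ : ‖x (n + 1) - u (n + 1)‖ ^ 2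
          ≤ ‖x (n + 1) - u n‖ ^ 2 + 2 * D * ‖u (n + 1) - u n‖ := by
        have a₁ := hD _ hxn _ hun
        have a₂ := hD _ hxn _ hun'
        have a₃ : ‖x (n + 1) - u (n + 1)‖ ≤ ‖x (n + 1) - u n‖ + ‖u (n + 1) - u n‖ := by
          rw [norm_sub_rev (u (n + 1))]
          exact norm_sub_le_norm_sub_add_norm_sub _ _ _
        nlinarith [norm_nonneg (x (n + 1) - u (n + 1)), norm_nonneg (x (n + 1) - u n),
          norm_nonneg (u (n + 1) - u n)]
      have h₃ : (‖x (n + 1) - u (n + 1)‖ ^ 2 - ‖x (n + 1 + 1) - u (n + 1)‖ ^ 2) / (2 * η)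
          ≤ (‖x (n + 1) - u n‖ ^ 2 + 2 * D * ‖u (n + 1) - u n‖
            - ‖x (n + 1 + 1) - u (n + 1)‖ ^ 2) / (2 * η) := by gcongr
      rw [Finset.sum_Icc_succ_top (by lia), Finset.sum_Ico_succ_top hn]
      refine (add_le_add (ih (by lia)) (h₁.trans (add_le_add_left h₃ _))).trans (le_of_eq ?_)
      push_cast
      ring
  refine (key T hT le_rfl).trans ?_
  gcongr
  linarith [sq_nonneg ‖x (T + 1) - u T‖]

end OnlineGradientDescent

section Potential

theorem one_le_anhPot (R : ℝ) {C : ℝ} (hC : 0 ≤ C) : 1 ≤ anhPot R C :=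
  Real.one_le_exp (by positivity)

theorem anhPot_zero_zero : anhPot 0 0 = 1 := by simp [anhPot]

theorem anhW_nonneg (R : ℝ) {C : ℝ} (hC : 0 ≤ C) : 0 ≤ anhW R C := by
  have : anhPot (R - 1) (C + 1) ≤ anhPot (R + 1) (C + 1) := by
    unfold anhPot
    gcongr
    linarith
  unfold anhW
  linarith

theorem anhW_zero_zero_pos : 0 < anhW 0 0 := by
  norm_num [anhW, anhPot]

/-- The mean of the potentials after a gain and after a loss of one unit. -/
theorem anhPot_average_le {R C : ℝ} (hRC : R ≤ C) (hC : 0 ≤ C) :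
    (anhPot (R + 1) (C + 1) + anhPot (R - 1) (C + 1)) / 2 ≤ anhPot R C + 1 := by
  set S := max R 0 with hS
  have hS0 : 0 ≤ S := le_max_right _ _
  have hSC : S ≤ C := max_le hRC hC
  have hRS : R ≤ S := le_max_left _ _
  have hplus : anhPot (R + 1) (C + 1) ≤ Real.exp ((S + 1) ^ 2 / (3 * (C + 1))) := by
    unfold anhPot
    gcongr
    exact max_le (by linarith) (by linarith)
  have hminus : anhPot (R - 1) (C + 1) ≤ Real.exp ((S - 1) ^ 2 / (3 * (C + 1))) := by
    refine Real.exp_le_exp.2 (div_le_div_of_nonneg_right ?_ (by positivity))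
    rw [← sq_abs (S - 1)]
    gcongr
    exact max_le ((by linarith : R - 1 ≤ S - 1).trans (le_abs_self _)) (abs_nonneg _)
  set a := S ^ 2 / (3 * C) with ha
  set δ := 1 / (3 * (C + 1)) with hδ
  have hδ0 : 0 ≤ δ := by positivity
  have hδ1 : δ ≤ 1 / 3 := by
    rw [hδ]
    apply one_div_le_one_div_of_le <;> linarith
  have hcosh : (Real.exp ((S + 1) ^ 2 / (3 * (C + 1)))
      + Real.exp ((S - 1) ^ 2 / (3 * (C + 1)))) / 2
      ≤ Real.exp ((S ^ 2 + 1) * δ + (2 * S * δ) ^ 2 / 2) := by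
    have h₁ : (S + 1) ^ 2 / (3 * (C + 1)) = (S ^ 2 + 1) * δ + 2 * S * δ := by
      rw [hδ]; ring
    have h₂ : (S - 1) ^ 2 / (3 * (C + 1)) = (S ^ 2 + 1) * δ + -(2 * S * δ) := by
      rw [hδ]; ring
    rw [h₁, h₂, Real.exp_add, Real.exp_add, Real.exp_add, ← mul_add, mul_div_assoc,
      ← Real.cosh_eq]
    gcongr
    exact Real.cosh_le_exp_half_sq _
  have hexponent : (S ^ 2 + 1) * δ + (2 * S * δ) ^ 2 / 2 ≤ (1 - δ) * a + δ * 1 := by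
    rcases hC.eq_or_lt with h0 | hpos
    · have : S = 0 := by linarith
      simp [ha, this]
    · have e : (1 - δ) * a + δ * 1 - ((S ^ 2 + 1) * δ + (2 * S * δ) ^ 2 / 2)
          = 2 * S ^ 2 / (9 * C * (C + 1) ^ 2) := by
        rw [ha, hδ]
        field_simp
        ring
      have : 0 ≤ 2 * S ^ 2 / (9 * C * (C + 1) ^ 2) := by positivity
      linarith
  have hconvex : Real.exp ((1 - δ) * a + δ * 1) ≤ (1 - δ) * Real.exp a + δ * Real.exp 1 := by
    simpa using convexOn_exp.2 (Set.mem_univ a) (Set.mem_univ 1)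
      (by linarith : 0 ≤ 1 - δ) hδ0 (by ring)
  have hpot : anhPot R C = Real.exp a := rfl
  have he := Real.exp_one_lt_d9
  have := Real.exp_le_exp.2 hexponent
  rw [hpot]
  nlinarith [Real.exp_pos a]

/-- Convexity of the potential along the segment from `(R, C)` to `(R + s, C + 1)`. -/
theorem anhPot_segment_le {R C s l : ℝ} (hRC : R ≤ C) (hC : 0 ≤ C) (hl0 : 0 ≤ l) (hl1 : l ≤ 1) :
    anhPot (R + l * s) (C + l) ≤ (1 - l) * anhPot R C + l * anhPot (R + s) (C + 1) := by
  rcases hl0.eq_or_lt with rfl | hl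
  · simp
  have hfrac : max (R + l * s) 0 ^ 2 / (3 * (C + l))
      ≤ (1 - l) * (max R 0 ^ 2 / (3 * C)) + l * (max (R + s) 0 ^ 2 / (3 * (C + 1))) := by
    set A := max R 0 with hA
    set B := max (R + s) 0 with hB
    have hA0 : 0 ≤ A := le_max_right _ _
    have hB0 : 0 ≤ B := le_max_right _ _
    have hmax : max (R + l * s) 0 ≤ (1 - l) * A + l * B := by
      refine max_le ?_ (by nlinarith)
      nlinarith [le_max_left R 0, le_max_left (R + s) 0]
    have hsq : max (R + l * s) 0 ^ 2 / (3 * (C + l))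
        ≤ ((1 - l) * A + l * B) ^ 2 / (3 * (C + l)) := by gcongr
    refine hsq.trans ?_
    rcases hC.eq_or_lt with h0 | hpos
    · have : A = 0 := max_eq_right (by linarith)
      rw [this, ← h0]
      simp
      apply le_of_eq
      field_simp
    · rw [← sub_nonneg]
      have e : (1 - l) * (A ^ 2 / (3 * C)) + l * (B ^ 2 / (3 * (C + 1)))
          - ((1 - l) * A + l * B) ^ 2 / (3 * (C + l))
          = (1 - l) * l * (A * (C + 1) - B * C) ^ 2 / (3 * C * (C + 1) * (C + l)) := by
        field_simp
        ring
      rw [e]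
      have : 0 ≤ 1 - l := by linarith
      positivity
  have hconvex := convexOn_exp.2 (Set.mem_univ (max R 0 ^ 2 / (3 * C)))
      (Set.mem_univ (max (R + s) 0 ^ 2 / (3 * (C + 1))))
      (by linarith : 0 ≤ 1 - l) hl0 (by ring)
  simp only [smul_eq_mul] at hconvex
  exact (Real.exp_le_exp.2 hfrac).trans hconvex

theorem anhPot_step_le {R C r : ℝ} (hRC : R ≤ C) (hC : 0 ≤ C) (hr : |r| ≤ 1) :
    anhPot (R + r) (C + |r|) ≤ anhPot R C + anhW R C * r + 1 := by
  have havg := anhPot_average_le hRC hC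
  have key : ∀ s : ℝ, |r| * s = r → anhPot (R + s) (C + 1)
      = s * anhW R C + (anhPot (R + 1) (C + 1) + anhPot (R - 1) (C + 1)) / 2 →
      anhPot (R + r) (C + |r|) ≤ anhPot R C + anhW R C * r + 1 := by
    intro s hs hpot
    have h := anhPot_segment_le (s := s) hRC hC (abs_nonneg r) hr
    rw [hs, hpot] at h
    have h₂ : |r| * (s * anhW R C) = anhW R C * r := by
      rw [← mul_assoc, hs, mul_comm]
    nlinarith [abs_nonneg r]
  rcases le_total 0 r with h | h
  · exact key 1 (by rw [mul_one, abs_of_nonneg h]) (by unfold anhW; ring)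
  · exact key (-1) (by rw [abs_of_nonpos h]; ring) (by unfold anhW; rw [← sub_eq_add_neg]; ring)

theorem le_sqrt_of_anhPot_le {R C M : ℝ} (hRC : R ≤ C) (hC : 0 ≤ C)
    (h : anhPot R C ≤ Real.exp M) : R ≤ Real.sqrt (3 * M * C) := by
  rw [anhPot, Real.exp_le_exp] at h
  rcases hC.eq_or_lt with h0 | hpos
  · exact (hRC.trans h0.ge).trans (Real.sqrt_nonneg _)
  · rw [div_le_iff₀ (by positivity)] at h
    refine (le_max_left R 0).trans (Real.le_sqrt_of_sq_le (by linarith))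

end Potential

section Covering

theorem dgcStart_le (k : ℕ) {t : ℕ} (ht : 1 ≤ t) : dgcStart k t ≤ t := by
  have := Nat.div_mul_le_self (t - 1) (2 ^ k)
  unfold dgcStart
  lia

theorem dgcStart_succ (k : ℕ) {t : ℕ} (ht : 1 ≤ t) :
    dgcStart k (t + 1) = t + 1 ∨ dgcStart k (t + 1) = dgcStart k t := by
  obtain ⟨n, rfl⟩ := Nat.exists_eq_add_of_le' ht
  simp only [dgcStart, Nat.add_sub_cancel]
  by_cases h : 2 ^ k ∣ n + 1
  · left
    rw [Nat.div_mul_cancel h]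
  · right
    rw [Nat.succ_div_of_not_dvd h]

theorem card_dgcLevels_le (T : ℕ) :
    ((dgcLevels T).card : ℝ) ≤ 1 + Real.logb 2 T := by
  have hsub : dgcLevels T ⊆ Finset.range (Nat.log 2 T + 1) := fun k hk => by
    rw [dgcLevels, Finset.mem_filter] at hk
    exact Finset.mem_range.2 (Nat.lt_succ_of_le (Nat.le_log_of_pow_le one_lt_two hk.2))
  have hcard : ((dgcLevels T).card : ℝ) ≤ Nat.log 2 T + 1 := by
    exact_mod_cast (Finset.card_le_card hsub).trans (Finset.card_range _).le
  have := Real.natLog_le_logb T 2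
  push_cast at this
  linarith

theorem mem_dgcLevels {T k : ℕ} : k ∈ dgcLevels T ↔ 2 ^ k ≤ T := by
  simp only [dgcLevels, Finset.mem_filter, Finset.mem_range, and_iff_right_iff_imp]
  exact fun h => (Nat.lt_two_pow_self.trans_le h).trans (Nat.lt_succ_self T)

/-- The level whose block length balances the two terms of the dynamic regret. -/
theorem exists_dgcLevel {T : ℕ} (hT : 1 ≤ T) {D P : ℝ} (hPT : P ≤ D * T) :
    ∃ k, 2 ^ k ≤ T ∧ P * 2 ^ k ≤ D * T ∧ (T < 2 ^ (k + 1) ∨ D * T < P * 2 ^ (k + 1)) := by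
  by_contra! h
  have hall : ∀ k, 2 ^ k ≤ T ∧ P * 2 ^ k ≤ D * T := by
    intro k
    induction k with
    | zero => simpa using ⟨hT, hPT⟩
    | succ k ih => exact h k ih.1 ih.2
  exact absurd (hall T).1 (not_le.2 Nat.lt_two_pow_self)

end Covering

section BlockPotential

/-- The potential, after round `t`, of the block of level `k` containing `t`, for the
instantaneous regrets `g`. -/
noncomputable def blockPot (g : ℕ → ℝ) (k t : ℕ) : ℝ :=
  anhPot (∑ i ∈ Finset.Icc (dgcStart k t) t, g i) (∑ i ∈ Finset.Icc (dgcStart k t) t, |g i|)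

/-- The potential, before round `t`, of the block of level `k` containing `t`. -/
noncomputable def blockPotBefore (g : ℕ → ℝ) (k t : ℕ) : ℝ :=
  anhPot (∑ i ∈ Finset.Icc (dgcStart k t) (t - 1), g i)
    (∑ i ∈ Finset.Icc (dgcStart k t) (t - 1), |g i|)

theorem sum_abs_nonneg (s : Finset ℕ) (g : ℕ → ℝ) : 0 ≤ ∑ i ∈ s, |g i| :=
  Finset.sum_nonneg fun _ _ => abs_nonneg _

theorem sum_le_sum_abs (s : Finset ℕ) (g : ℕ → ℝ) : ∑ i ∈ s, g i ≤ ∑ i ∈ s, |g i| :=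
  Finset.sum_le_sum fun _ _ => le_abs_self _

theorem blockPotBefore_eq_one {g : ℕ → ℝ} {k t : ℕ} (ht : 1 ≤ t) (h : dgcStart k t = t) :
    blockPotBefore g k t = 1 := by
  rw [blockPotBefore, h, Finset.Icc_eq_empty (by lia)]
  simpa using anhPot_zero_zero

theorem blockPot_le_step {g : ℕ → ℝ} (k : ℕ) {t : ℕ} (ht : 1 ≤ t) (hg : |g t| ≤ 1) :
    blockPot g k t - blockPotBefore g k t
      ≤ anhW (∑ i ∈ Finset.Icc (dgcStart k t) (t - 1), g i)
          (∑ i ∈ Finset.Icc (dgcStart k t) (t - 1), |g i|) * g t + 1 := by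
  have h := anhPot_step_le (sum_le_sum_abs (Finset.Icc (dgcStart k t) (t - 1)) g)
    (sum_abs_nonneg _ g) hg
  have hle := dgcStart_le k ht
  obtain ⟨n, rfl⟩ := Nat.exists_eq_add_of_le' ht
  simp only [Nat.add_sub_cancel] at h
  rw [← Finset.sum_Icc_succ_top hle, ← Finset.sum_Icc_succ_top hle] at h
  simp only [blockPot, blockPotBefore, Nat.add_sub_cancel]
  linarith

theorem blockPot_sub_one_le_sum (g : ℕ → ℝ) (k : ℕ) {t : ℕ} (ht : 1 ≤ t) :
    blockPot g k t - 1 ≤ ∑ i ∈ Finset.Icc 1 t, (blockPot g k i - blockPotBefore g k i) := by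
  induction t, ht using Nat.le_induction with
  | base => simp [blockPotBefore_eq_one le_rfl (show dgcStart k 1 = 1 by simp [dgcStart])]
  | succ t ht ih =>
    rw [Finset.sum_Icc_succ_top (by lia)]
    rcases dgcStart_succ k ht with h | h
    · have h₁ : 1 ≤ blockPot g k t := one_le_anhPot _ (sum_abs_nonneg _ g)
      rw [blockPotBefore_eq_one (by lia) h]
      linarith
    · have h₁ : blockPotBefore g k (t + 1) = blockPot g k t := by
        simp [blockPot, blockPotBefore, h]
      rw [h₁]
      linarith

theorem blockPot_le {T : ℕ} {L : Finset ℕ} {g : ℕ → ℕ → ℝ}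
    (hg : ∀ k t, 1 ≤ t → |g k t| ≤ 1)
    (hw : ∀ t, 1 ≤ t → ∑ k ∈ L, anhW (∑ i ∈ Finset.Icc (dgcStart k t) (t - 1), g k i)
      (∑ i ∈ Finset.Icc (dgcStart k t) (t - 1), |g k i|) * g k t ≤ 0)
    {k t : ℕ} (hk : k ∈ L) (ht : 1 ≤ t) (htT : t ≤ T) :
    blockPot (g k) k t ≤ 1 + T * L.card := by
  have hround : ∀ i ∈ Finset.Icc 1 t,
      ∑ j ∈ L, (blockPot (g j) j i - blockPotBefore (g j) j i) ≤ L.card := by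
    intro i hi
    have hi1 := (Finset.mem_Icc.1 hi).1
    refine (Finset.sum_le_sum fun j _ => blockPot_le_step j hi1 (hg j i hi1)).trans ?_
    rw [Finset.sum_add_distrib, Finset.sum_const, nsmul_one]
    linarith [hw i hi1]
  have hlevel : ∀ j, blockPot (g j) j t - 1
      ≤ ∑ i ∈ Finset.Icc 1 t, (blockPot (g j) j i - blockPotBefore (g j) j i) :=
    fun j => blockPot_sub_one_le_sum (g j) j ht
  have hnonneg : ∀ j ∈ L,
      0 ≤ ∑ i ∈ Finset.Icc 1 t, (blockPot (g j) j i - blockPotBefore (g j) j i) := fun j _ =>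
    (sub_nonneg.2 (one_le_anhPot _ (sum_abs_nonneg _ (g j)))).trans (hlevel j)
  have htotal := (hlevel k).trans (Finset.single_le_sum hnonneg hk)
  rw [Finset.sum_comm] at htotal
  have hsum := Finset.sum_le_sum hround
  rw [Finset.sum_const, Nat.card_Icc, nsmul_eq_mul, Nat.add_sub_cancel] at hsum
  have : (t : ℝ) * L.card ≤ T * L.card := by gcongr
  linarith

theorem sqrt_add_sqrt_le {M n A B : ℝ} (hM : 0 ≤ M) (hn : 0 ≤ n) (hA : 0 ≤ A) (hB : 0 ≤ B) :
    √(M * n * A) + √(M * B) ≤ √(M * (n + 1) * (A + B)) := by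
  refine Real.le_sqrt_of_sq_le ?_
  have h₁ := Real.sq_sqrt (show 0 ≤ M * n * A by positivity)
  have h₂ := Real.sq_sqrt (show 0 ≤ M * B by positivity)
  have h₃ : √(M * n * A) * √(M * B) = √(M * A) * √(M * n * B) := by
    rw [← Real.sqrt_mul (by positivity), ← Real.sqrt_mul (by positivity)]
    congr 1
    ring
  have h₄ := Real.sq_sqrt (show 0 ≤ M * A by positivity)
  have h₅ := Real.sq_sqrt (show 0 ≤ M * n * B by positivity)
  nlinarith [sq_nonneg (√(M * A) - √(M * n * B))]

/-- Regret bounds on the blocks of one level add up by the Cauchy–Schwarz inequality. -/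
theorem sum_le_sqrt_of_block {g : ℕ → ℝ} {M : ℝ} (hM : 0 ≤ M) {k T : ℕ}
    (hblock : ∀ t, 1 ≤ t → t ≤ T →
      ∑ i ∈ Finset.Icc (dgcStart k t) t, g i ≤ √(M * ((t + 1 - dgcStart k t : ℕ) : ℝ)))
    (b : ℕ) {t : ℕ} (htT : t ≤ T) (hbt : b * 2 ^ k < t) (htb : t ≤ (b + 1) * 2 ^ k) :
    ∑ i ∈ Finset.Icc 1 t, g i ≤ √(M * (b + 1) * t) := by
  have hpos : 0 < 2 ^ k := by positivity
  induction b generalizing t with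
  | zero =>
    have hs : dgcStart k t = 1 := by
      have : (t - 1) / 2 ^ k = 0 := Nat.div_eq_of_lt (by lia)
      simp [dgcStart, this]
    simpa [hs] using hblock t (by lia) htT
  | succ b ih =>
    have hs : dgcStart k t = (b + 1) * 2 ^ k + 1 := by
      have : (t - 1) / 2 ^ k = b + 1 := by
        rw [Nat.div_eq_iff hpos]
        constructor <;> lia
      simp [dgcStart, this]
    have h₁ := ih (t := (b + 1) * 2 ^ k) (by lia) (by lia) le_rfl
    have h₂ := hblock t (by lia) htT
    have hlen : t + 1 - ((b + 1) * 2 ^ k + 1) = t - (b + 1) * 2 ^ k := by lia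
    rw [hs, hlen] at h₂
    have hsplit : ∑ i ∈ Finset.Icc 1 t, g i = ∑ i ∈ Finset.Icc 1 ((b + 1) * 2 ^ k), g i
        + ∑ i ∈ Finset.Icc ((b + 1) * 2 ^ k + 1) t, g i := by
      simp only [← Finset.Ico_add_one_right_eq_Icc]
      exact (Finset.sum_Ico_consecutive g (by lia) (by lia)).symm
    have h₃ := sqrt_add_sqrt_le (M := M) (n := (b : ℝ) + 1)
      (A := (((b + 1) * 2 ^ k : ℕ) : ℝ)) (B := ((t - (b + 1) * 2 ^ k : ℕ) : ℝ)) hM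
      (by positivity) (by positivity) (by positivity)
    have h₄ : (((b + 1) * 2 ^ k : ℕ) : ℝ) + ((t - (b + 1) * 2 ^ k : ℕ) : ℝ) = t := by
      rw [← Nat.cast_add, Nat.add_sub_cancel' hbt.le]
    rw [h₄] at h₃
    rw [hsplit]
    push_cast at h₁ h₂ h₃ ⊢
    linarith

theorem cAOD_nonneg {T : ℕ} (hT : 1 ≤ T) : 0 ≤ cAOD T T := by
  have hT' : (1 : ℝ) ≤ T := by exact_mod_cast hT
  have h₁ := Real.log_nonneg hT'
  have h₂ := Real.logb_nonneg one_lt_two hT'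
  have h₃ := Real.log_nonneg (by linarith : 1 ≤ 1 + Real.logb 2 T)
  have h₄ := Real.log_nonneg (by linarith : 1 ≤ 1 + (T : ℝ))
  have h₅ := Real.log_nonneg (by linarith : 1 ≤ (5 + 3 * Real.log (1 + (T : ℝ))) / 2)
  unfold cAOD
  linarith

theorem one_add_mul_card_le_exp_cAOD {T : ℕ} (hT : 1 ≤ T) :
    1 + T * ((dgcLevels T).card : ℝ) ≤ Real.exp (cAOD T T) := by
  have hT' : (1 : ℝ) ≤ T := by exact_mod_cast hT
  have hL := card_dgcLevels_le T
  have h₂ := Real.logb_nonneg one_lt_two hT'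
  have h₄ := Real.log_nonneg (by linarith : 1 ≤ 1 + (T : ℝ))
  have he := Real.add_one_le_exp (1 : ℝ)
  rw [cAOD, Real.exp_add, Real.exp_add, Real.exp_add, Real.exp_log (by linarith),
    Real.exp_log (by linarith), Real.exp_log (by linarith)]
  set l := 1 + Real.logb 2 (T : ℝ)
  have h₅ : 1 ≤ T * l := by nlinarith
  calc 1 + T * ((dgcLevels T).card : ℝ) ≤ T * l + T * l := by gcongr
    _ = 2 * T * l * 1 := by ring
    _ ≤ Real.exp 1 * T * l * ((5 + 3 * Real.log (1 + (T : ℝ))) / 2) := by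
      gcongr <;> linarith

theorem sum_block_le_sqrt {T : ℕ} {g : ℕ → ℕ → ℝ} (hg : ∀ k t, 1 ≤ t → |g k t| ≤ 1)
    (hw : ∀ t, 1 ≤ t → ∑ k ∈ dgcLevels T,
      anhW (∑ i ∈ Finset.Icc (dgcStart k t) (t - 1), g k i)
      (∑ i ∈ Finset.Icc (dgcStart k t) (t - 1), |g k i|) * g k t ≤ 0)
    {k t : ℕ} (hk : k ∈ dgcLevels T) (ht : 1 ≤ t) (htT : t ≤ T) :
    ∑ i ∈ Finset.Icc (dgcStart k t) t, g k i
      ≤ √(3 * cAOD T T * ((t + 1 - dgcStart k t : ℕ) : ℝ)) := by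
  have hT := ht.trans htT
  refine (le_sqrt_of_anhPot_le (sum_le_sum_abs _ _) (sum_abs_nonneg _ _)
    ((blockPot_le hg hw hk ht htT).trans (one_add_mul_card_le_exp_cAOD hT))).trans ?_
  have hc := cAOD_nonneg hT
  gcongr
  rw [← Nat.card_Icc]
  refine (Finset.sum_le_card_nsmul _ _ 1 fun i hi => hg k i ?_).trans_eq (by simp)
  exact (Nat.le_add_left 1 _).trans (Finset.mem_Icc.1 hi).1

end BlockPotential

section Tuning

theorem ogd_bound_le {D G P T m : ℝ} (hD : 0 < D) (hG : 0 < G) (hP : 0 ≤ P) (hm : 0 < m)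
    (hmT : m ^ 2 ≤ T) (hPm : P * m ^ 2 ≤ D * T) (hDT : D * T ≤ m ^ 2 * (2 * D + 2 * P)) :
    (D ^ 2 + 2 * D * P) / (2 * (D / (G * m))) + D / (G * m) * T * G ^ 2 / 2
      ≤ (3 * D * G / 2 + 5 * G / 2 * √(D * P)) * √T := by
  have hT : 0 ≤ T := (sq_nonneg m).trans hmT
  have hr := Real.sq_sqrt (mul_nonneg hD.le hP)
  have hs := Real.sq_sqrt hT
  set r := √(D * P)
  set s := √T
  have hr0 : 0 ≤ r := Real.sqrt_nonneg _
  have hs0 : 0 ≤ s := Real.sqrt_nonneg _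
  have h₁ : m ≤ s := Real.le_sqrt_of_sq_le hmT
  have h₂ : m * P ≤ r * s := by
    refine (sq_le_sq₀ (by positivity) (by positivity)).1 ?_
    rw [mul_pow, mul_pow, hr, hs]
    nlinarith
  have h₃ : D * T / m ≤ 3 / 2 * (D + r) * s := by
    rw [div_le_iff₀ hm]
    refine (sq_le_sq₀ (by positivity) (by positivity)).1 ?_
    calc (D * T) ^ 2 ≤ D * T * (m ^ 2 * (2 * D + 2 * P)) := by
          rw [sq]; gcongr
      _ = (2 * D ^ 2 + 2 * r ^ 2) * (T * m ^ 2) := by rw [hr]; ring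
      _ ≤ (9 / 4 * (D + r) ^ 2) * (T * m ^ 2) := by
          gcongr
          nlinarith [mul_nonneg hD.le hr0, sq_nonneg D, sq_nonneg r]
      _ = _ := by rw [← hs]; ring
  have h₄ : (D ^ 2 + 2 * D * P) / (2 * (D / (G * m))) + D / (G * m) * T * G ^ 2 / 2
      = G / 2 * (m * D + 2 * (m * P) + D * T / m) := by
    field_simp
  rw [h₄]
  calc G / 2 * (m * D + 2 * (m * P) + D * T / m)
      ≤ G / 2 * (s * D + 2 * (r * s) + 3 / 2 * (D + r) * s) := by gcongr
    _ ≤ _ := by nlinarith [mul_nonneg hG.le (mul_nonneg hD.le hs0),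
        mul_nonneg hG.le (mul_nonneg hr0 hs0)]

theorem block_count_le {T k : ℕ} {D P : ℝ} (hT : 1 ≤ T) (hD : 0 < D) (hP : 0 ≤ P)
    (h : T < 2 ^ (k + 1) ∨ D * T < P * 2 ^ (k + 1)) :
    (((T - 1) / 2 ^ k : ℕ) : ℝ) + 1 ≤ 2 * (1 + 2 * P / D) := by
  have hq : 0 ≤ 2 * P / D := by positivity
  rcases h with h | h
  · have : (T - 1) / 2 ^ k ≤ 1 := by
      rw [← Nat.lt_succ_iff, Nat.div_lt_iff_lt_mul (by positivity)]
      rw [pow_succ] at h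
      lia
    have : (((T - 1) / 2 ^ k : ℕ) : ℝ) ≤ 1 := by exact_mod_cast this
    linarith
  · have hb : (((T - 1) / 2 ^ k : ℕ) : ℝ) * 2 ^ k ≤ T := by
      exact_mod_cast (Nat.div_mul_le_self _ _).trans (Nat.sub_le T 1)
    have : (((T - 1) / 2 ^ k : ℕ) : ℝ) ≤ 2 * P / D := by
      rw [le_div_iff₀ hD]
      refine le_of_mul_le_mul_right ?_ (show (0 : ℝ) < 2 ^ k by positivity)
      rw [pow_succ] at h
      nlinarith
    linarith

end Tuning

/-- Theorem 5, dynamic regret of AOD: under the AOD algorithm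
with horizon `T`, for every comparator sequence `u` in `Ω` with path-length `P_T`,
the dynamic regret is at most
`(3DG/2 + (5G/2)√(DP_T) + √(6c(T)(1 + 2P_T/D)))·√T`. -/
theorem aod_dynamic_regret
    (d T : ℕ) (hT : 1 ≤ T) (D G : ℝ)
    (Ω : Set (EuclideanSpace ℝ (Fin d)))
    (hne : Ω.Nonempty) (hcomp : IsCompact Ω) (hconv : Convex ℝ Ω)
    (hdiam : ∀ z ∈ Ω, ∀ z' ∈ Ω, ‖z - z'‖ ≤ D)
    (f : ℕ → EuclideanSpace ℝ (Fin d) → ℝ)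
    (hfconv : ∀ t, ConvexOn ℝ Set.univ (f t))
    (hfdiff : ∀ t z, DifferentiableAt ℝ (f t) z)
    (hgrad : ∀ t, ∀ z ∈ Ω, ‖gradient (f t) z‖ ≤ G)
    (hrange : ∀ t, ∀ z ∈ Ω, 0 ≤ f t z ∧ f t z ≤ 1)
    (proj : EuclideanSpace ℝ (Fin d) → EuclideanSpace ℝ (Fin d))
    (hproj : ∀ z, proj z ∈ Ω ∧ ∀ z' ∈ Ω, ‖proj z - z‖ ≤ ‖z' - z‖)
    (x : ℕ → ℕ → EuclideanSpace ℝ (Fin d))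
    (hx1 : ∀ k, x k 1 ∈ Ω)
    (hxup : ∀ k t, 1 ≤ t →
      x k (t + 1) = proj (x k t - (D / (G * Real.sqrt ((2 : ℝ) ^ k))) • gradient (f t) (x k t)))
    (w : ℕ → EuclideanSpace ℝ (Fin d))
    (hw : ∀ t, 1 ≤ t → w t = ∑ k ∈ dgcLevels T, aodWeight T f w x k t • x k t)
    (u : ℕ → EuclideanSpace ℝ (Fin d))
    (hu : ∀ t, 1 ≤ t → t ≤ T → u t ∈ Ω)
    (P : ℝ) (hP : P = ∑ t ∈ Finset.Ico 1 T, ‖u (t + 1) - u t‖) :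
    ∑ t ∈ Finset.Icc 1 T, f t (w t) - ∑ t ∈ Finset.Icc 1 T, f t (u t)
      ≤ (3 * D * G / 2 + 5 * G / 2 * Real.sqrt (D * P)
          + Real.sqrt (6 * cAOD T T * (1 + 2 * P / D))) * Real.sqrt (T : ℝ) := by
  have hx : ∀ k t, 1 ≤ t → x k t ∈ Ω := by
    intro k t ht
    induction t, ht using Nat.le_induction with
    | base => exact hx1 k
    | succ t ht _ => exact hxup k t ht ▸ (hproj _).1
  have hD0 : 0 ≤ D := (norm_nonneg _).trans (hdiam _ (hx 0 1 le_rfl) _ (hx 0 1 le_rfl))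
  have hG0 : 0 ≤ G := (norm_nonneg _).trans (hgrad 0 _ (hx 0 1 le_rfl))
  have hwnonneg : ∀ k t, 0 ≤ anhW (aodMetaR f w x k t) (aodMetaC f w x k t) := fun k t =>
    anhW_nonneg _ (Finset.sum_nonneg fun _ _ => abs_nonneg _)
  have hsumpos : ∀ t, 1 ≤ t →
      0 < ∑ k ∈ dgcLevels T, anhW (aodMetaR f w x k t) (aodMetaC f w x k t) := by
    intro t ht
    refine Finset.sum_pos' (fun k _ => hwnonneg k t)
      ⟨0, mem_dgcLevels.2 (by simpa using hT), ?_⟩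
    have hs : dgcStart 0 t = t := by
      simp only [dgcStart, pow_zero, Nat.div_one, mul_one]
      lia
    rw [aodMetaR, aodMetaC, hs, Finset.Icc_eq_empty (by lia)]
    simpa using anhW_zero_zero_pos
  have hpnonneg : ∀ t, ∀ k ∈ dgcLevels T, 0 ≤ aodWeight T f w x k t := fun t k _ =>
    div_nonneg (hwnonneg k t) (Finset.sum_nonneg fun k' _ => hwnonneg k' t)
  have hpsum : ∀ t, 1 ≤ t → ∑ k ∈ dgcLevels T, aodWeight T f w x k t = 1 := by
    intro t ht
    simp only [aodWeight]
    rw [← Finset.sum_div, div_self (hsumpos t ht).ne']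
  have hwmem : ∀ t, 1 ≤ t → w t ∈ Ω := fun t ht => hw t ht ▸
    hconv.sum_mem (hpnonneg t) (hpsum t ht) fun k _ => hx k t ht
  have hg : ∀ k t, 1 ≤ t → |f t (w t) - f t (x k t)| ≤ 1 := by
    intro k t ht
    have h₁ := hrange t _ (hwmem t ht)
    have h₂ := hrange t _ (hx k t ht)
    rw [abs_le]
    constructor <;> linarith
  have hmeta : ∀ t, 1 ≤ t → ∑ k ∈ dgcLevels T,
      anhW (aodMetaR f w x k t) (aodMetaC f w x k t) * (f t (w t) - f t (x k t)) ≤ 0 := by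
    intro t ht
    have hjensen := (hfconv t).map_sum_le (hpnonneg t) (hpsum t ht)
      (fun k _ => Set.mem_univ (x k t))
    rw [← hw t ht] at hjensen
    have hsum : ∑ k ∈ dgcLevels T, aodWeight T f w x k t * (f t (w t) - f t (x k t)) ≤ 0 := by
      simp only [smul_eq_mul] at hjensen
      simp only [mul_sub, Finset.sum_sub_distrib, ← Finset.sum_mul, hpsum t ht]
      linarith
    simp only [aodWeight, div_mul_eq_mul_div] at hsum
    rw [← Finset.sum_div, div_nonpos_iff] at hsum
    rcases hsum with h | h
    · exact absurd (hsumpos t ht) (not_lt.2 h.2)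
    · exact h.1
  have hP0 : 0 ≤ P := hP ▸ Finset.sum_nonneg fun _ _ => norm_nonneg _
  have hc := cAOD_nonneg hT
  rcases (mul_nonneg hG0 hD0).eq_or_lt with hGD | hGD
  · have hle : ∑ t ∈ Finset.Icc 1 T, f t (w t) ≤ ∑ t ∈ Finset.Icc 1 T, f t (u t) := by
      refine Finset.sum_le_sum fun t ht => ?_
      obtain ⟨ht1, htT⟩ := Finset.mem_Icc.1 ht
      have h₁ := (hfconv t).sub_le_inner_gradient (hfdiff t (w t)) (u t)
      have h₂ := real_inner_le_norm (gradient (f t) (w t)) (w t - u t)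
      have h₃ : ‖gradient (f t) (w t)‖ * ‖w t - u t‖ ≤ G * D :=
        mul_le_mul (hgrad t _ (hwmem t ht1)) (hdiam _ (hwmem t ht1) _ (hu t ht1 htT))
          (norm_nonneg _) hG0
      linarith
    refine (sub_nonpos.2 hle).trans ?_
    positivity
  have hD : 0 < D := pos_of_mul_pos_right hGD hG0
  have hG : 0 < G := pos_of_mul_pos_left hGD hD0
  have hPT : P ≤ D * T := by
    have h : P ≤ ((Finset.Ico 1 T).card : ℝ) * D := by
      rw [hP, ← nsmul_eq_mul]
      refine Finset.sum_le_card_nsmul _ _ _ fun t ht => ?_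
      obtain ⟨ht1, htT⟩ := Finset.mem_Ico.1 ht
      exact hdiam _ (hu _ (by lia) (by lia)) _ (hu _ ht1 htT.le)
    have hcard : ((Finset.Ico 1 T).card : ℝ) ≤ T := by simp
    nlinarith
  obtain ⟨k, hkT, hPk, hk⟩ := exists_dgcLevel hT hPT
  have hexpert : ∑ t ∈ Finset.Icc 1 T, (f t (x k t) - f t (u t))
      ≤ (3 * D * G / 2 + 5 * G / 2 * √(D * P)) * √T := by
    have hm : √((2 : ℝ) ^ k) ^ 2 = 2 ^ k := Real.sq_sqrt (by positivity)
    have hstep : ∀ t, 1 ≤ t → ∀ a ∈ Ω,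
        ‖x k (t + 1) - (x k t - (D / (G * √((2 : ℝ) ^ k))) • gradient (f t) (x k t))‖
          ≤ ‖a - (x k t - (D / (G * √((2 : ℝ) ^ k))) • gradient (f t) (x k t))‖ := by
      intro t ht
      rw [hxup k t ht]
      exact (hproj _).2
    refine (ogd_dynamic_regret hconv hT (by positivity) hdiam hfconv hfdiff hgrad (hx k) hu
      hstep).trans ?_
    rw [← hP]
    refine ogd_bound_le hD hG hP0 (by positivity) ?_ (by rwa [hm]) ?_
    · rw [hm]
      exact_mod_cast hkT
    · rw [hm]
      rcases hk with h | h
      · have h' : (T : ℝ) ≤ 2 ^ (k + 1) := by exact_mod_cast h.le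
        rw [pow_succ] at h'
        nlinarith [mul_nonneg hP0 (show (0 : ℝ) ≤ 2 ^ k by positivity)]
      · rw [pow_succ] at h
        nlinarith [mul_nonneg hD0 (show (0 : ℝ) ≤ 2 ^ k by positivity)]
  have htrack : ∑ t ∈ Finset.Icc 1 T, (f t (w t) - f t (x k t))
      ≤ √(6 * cAOD T T * (1 + 2 * P / D)) * √T := by
    have hdiv := Nat.div_add_mod' (T - 1) (2 ^ k)
    have hmod := Nat.mod_lt (T - 1) (show 0 < 2 ^ k by positivity)
    refine (sum_le_sqrt_of_block (by positivity) (fun t ht htT =>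
      sum_block_le_sqrt hg hmeta (mem_dgcLevels.2 hkT) ht htT) ((T - 1) / 2 ^ k) le_rfl
      (by lia) (by rw [add_one_mul]; lia)).trans ?_
    rw [← Real.sqrt_mul (by positivity)]
    refine Real.sqrt_le_sqrt (mul_le_mul_of_nonneg_right ?_ (Nat.cast_nonneg T))
    nlinarith [block_count_le hT hD hP0 hk]
  calc ∑ t ∈ Finset.Icc 1 T, f t (w t) - ∑ t ∈ Finset.Icc 1 T, f t (u t)
      = ∑ t ∈ Finset.Icc 1 T, (f t (x k t) - f t (u t))
        + ∑ t ∈ Finset.Icc 1 T, (f t (w t) - f t (x k t)) := by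
        simp only [Finset.sum_sub_distrib]
        ring
    _ ≤ _ := by
        rw [add_mul]
        exact add_le_add hexpert htrack
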